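/- arXiv:1706.04233 — 3 statements merged into one kernel-verified Lean document; each statement's English description precedes it below -/
import Mathlib

section
/- Let A be a reduced order with the inner product ⟨x,y⟩ = ∑_{σ: A→ℂ} σ(x)·conj(σ(y)). Then for every x ∈ A, ⟨x,x⟩ ≥ #{σ : A → ℂ ring homomorphism with σ(x) ≠ 0}. -/
/-- The natural inner product on a (reduced) order:
`⟨x, y⟩ = ∑ σ, σ x * conj (σ y)`, where `σ` ranges over all ring homomorphisms
`A → ℂ` (a finite set when `A` is a reduced order); the value is real. -/
noncomputable def ordPairing (A : Type*) [CommRing A] (x y : A) : ℝ :=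
  ∑ᶠ σ : A →+* ℂ, (σ x * (starRingEnd ℂ) (σ y)).re


/-- The product of the nonzero values of `x` under all homs to a Galois extension of `ℚ` is a
rational integer. -/
theorem prod_nonzero_int {A K : Type*} [CommRing A] [Module.Finite ℤ A] [Field K] [Algebra ℚ K]
    [IsGalois ℚ K] (S : Finset (A →+* K)) (x : A) (hS : ∀ σ, σ ∈ S ↔ σ x ≠ 0) :
    ∃ n : ℤ, (n : K) = ∏ σ ∈ S, σ x := by
  have hint : IsIntegral ℤ (∏ σ ∈ S, σ x) := by
    refine IsIntegral.prod _ fun σ _ => ?_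
    exact (Algebra.IsIntegral.isIntegral (R := ℤ) x).map σ.toIntAlgHom
  have hfix : ∀ f : Gal(K/ℚ), f (∏ σ ∈ S, σ x) = ∏ σ ∈ S, σ x := by
    intro f
    rw [map_prod]
    refine Finset.prod_bij' (fun σ _ => (f : K →+* K).comp σ)
      (fun σ _ => (f.symm : K →+* K).comp σ) ?_ ?_ ?_ ?_ ?_
    · intro σ h
      rw [hS] at h ⊢
      simpa using h
    · intro σ h
      rw [hS] at h ⊢
      simpa using h
    · intro σ _
      ext a
      simp
    · intro σ _
      ext a
      simp
    · intro σ _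
      simp
  obtain ⟨q, hq⟩ := (InfiniteGalois.mem_range_algebraMap_iff_fixed (k := ℚ) _).2 hfix
  rw [← hq] at hint ⊢
  rw [isIntegral_algebraMap_iff (algebraMap ℚ K).injective] at hint
  obtain ⟨n, rfl⟩ := IsIntegrallyClosed.isIntegral_iff.1 hint
  exact ⟨n, by simp⟩

theorem one_le_prod_nonzero {A : Type*} [CommRing A] [Module.Finite ℤ A]
    (S : Finset (A →+* ℂ)) (x : A) (hS : ∀ σ, σ ∈ S ↔ σ x ≠ 0) :
    1 ≤ ∏ σ ∈ S, ‖σ x‖ := by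
  classical
  let K := algebraicClosure ℚ ℂ
  have : IsAlgClosure ℚ K := algebraicClosure.isAlgClosure (F := ℚ) (E := ℂ)
  have : IsGalois ℚ K := IsAlgClosure.isGalois ℚ K
  have hmem : ∀ (σ : A →+* ℂ) (a : A), σ a ∈ K.toSubring := by
    intro σ a
    have h : IsIntegral ℤ (σ a) :=
      (Algebra.IsIntegral.isIntegral (R := ℤ) a).map σ.toIntAlgHom
    exact (mem_algebraicClosure_iff'.2 h.tower_top : σ a ∈ algebraicClosure ℚ ℂ)
  let g : (A →+* ℂ) → (A →+* K) := fun σ => σ.codRestrict K.toSubring (hmem σ)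
  have hg : ∀ σ a, ((g σ a : K) : ℂ) = σ a := fun σ a => rfl
  have hinj : Function.Injective g := by
    intro σ τ h
    ext a
    rw [← hg, h, hg]
  obtain ⟨n, hn⟩ := prod_nonzero_int (S.image g) x (by
    intro τ
    rw [Finset.mem_image]
    constructor
    · rintro ⟨σ, h, rfl⟩ h0
      exact (hS σ).1 h (by rw [← hg, h0]; rfl)
    · intro h
      refine ⟨(algebraMap K ℂ).comp τ, (hS _).2 ?_, ?_⟩
      · simpa using h
      · ext a
        rfl)
  rw [Finset.prod_image hinj.injOn] at hn
  have hn' : (n : ℂ) = ∏ σ ∈ S, σ x := by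
    have := congrArg (algebraMap K ℂ) hn
    rw [map_prod, map_intCast] at this
    exact this
  have h0 : n ≠ 0 := by
    rintro rfl
    rw [Int.cast_zero] at hn'
    exact Finset.prod_ne_zero_iff.2 (fun σ h => (hS σ).1 h) hn'.symm
  rw [← norm_prod, ← hn', Complex.norm_intCast]
  exact_mod_cast Int.one_le_abs h0

/-- In a reduced order, `⟨x,x⟩` is at least the number of ring homomorphisms
`σ : A → ℂ` with `σ x ≠ 0`. -/
theorem ordPairing_self_ge_card_nonvanishing {A : Type*} [CommRing A] [IsReduced A]
    [Module.Free ℤ A] [Module.Finite ℤ A] (x : A) :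
    (Set.ncard {σ : A →+* ℂ | σ x ≠ 0} : ℝ) ≤ ordPairing A x x := by
  classical
  have : Finite (A →+* ℂ) :=
    Finite.of_injective (β := A →ₐ[ℤ] ℂ) (fun σ => σ.toIntAlgHom) (by
      intro σ τ h
      ext a
      exact DFunLike.congr_fun h a)
  have := Fintype.ofFinite (A →+* ℂ)
  set S : Finset (A →+* ℂ) := Finset.univ.filter fun σ => σ x ≠ 0 with hSdef
  have hS : ∀ σ, σ ∈ S ↔ σ x ≠ 0 := by simp [S]
  have hcard : {σ : A →+* ℂ | σ x ≠ 0} = (S : Set (A →+* ℂ)) := by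
    ext σ
    simp [S]
  rw [hcard, Set.ncard_coe_finset, ordPairing, finsum_eq_sum_of_fintype]
  have hterm : ∀ σ : A →+* ℂ, (σ x * (starRingEnd ℂ) (σ x)).re = ‖σ x‖ ^ 2 := by
    intro σ
    rw [Complex.mul_conj, Complex.normSq_eq_norm_sq, Complex.ofReal_re]
  simp only [hterm]
  have h1 : ∑ σ ∈ S, ‖σ x‖ ^ 2 ≤ ∑ σ : A →+* ℂ, ‖σ x‖ ^ 2 :=
    Finset.sum_le_sum_of_subset_of_nonneg (Finset.subset_univ _) fun _ _ _ => by positivity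
  refine le_trans ?_ h1
  have h2 : 0 ≤ ∑ σ ∈ S, Real.log (‖σ x‖ ^ 2) := by
    rw [← Real.log_prod fun σ h => pow_ne_zero 2 (norm_ne_zero_iff.2 ((hS σ).1 h)),
      Finset.prod_pow]
    exact Real.log_nonneg (one_le_pow₀ (one_le_prod_nonzero S x hS))
  have h3 : ∑ σ ∈ S, Real.log (‖σ x‖ ^ 2) ≤ ∑ σ ∈ S, (‖σ x‖ ^ 2 - 1) := by
    refine Finset.sum_le_sum fun σ h => Real.log_le_sub_one_of_pos ?_
    have := norm_pos_iff.2 ((hS σ).1 h)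
    positivity
  rw [Finset.sum_sub_distrib] at h3
  simp only [Finset.sum_const, nsmul_eq_mul, mul_one] at h3
  linarith
end

section
/- Let A be a reduced order with inner product ⟨x,y⟩ = ∑_{σ: A→ℂ} σ(x)·conj(σ(y)). Then the map e ↦ (e, 1−e) is a bijection from the set of idempotents of A to the set of decompositions of 1, i.e., pairs (x,y) ∈ A × A with x + y = 1 and ⟨x,y⟩ ≥ 0. In particular, A is connected (has exactly the two idempotents 0 and 1, with 0 ≠ 1) if and only if 1 is indecomposable in the lattice A (the only decompositions of 1 are (1,0) and (0,1)). -/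
/-- There are finitely many ring homomorphisms from an order to `ℂ`. -/
lemma ord_finite_homs (A : Type*) [CommRing A] [Module.Finite ℤ A] : Finite (A →+* ℂ) := by
  have h : Finite (A →ₐ[ℤ] ℂ) := inferInstance
  exact Finite.of_injective (fun σ : A →+* ℂ => (σ.toIntAlgHom : A →ₐ[ℤ] ℂ)) (by
    intro σ τ h
    ext a
    exact DFunLike.congr_fun h a)

/-- The homomorphisms to `ℂ` separate points from zero. -/
lemma ord_exists_hom {A : Type*} [CommRing A] [IsReduced A]
    [Module.Free ℤ A] [Module.Finite ℤ A] (z : A) (hz : z ≠ 0) : ∃ σ : A →+* ℂ, σ z ≠ 0 := by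
  let M : Submonoid A :=
    { carrier := {a | ∃ n : ℤ, n ≠ 0 ∧ ∃ k : ℕ, a = n • z ^ k}
      one_mem' := ⟨1, one_ne_zero, 0, by simp⟩
      mul_mem' := by
        rintro a b ⟨n, hn, k, rfl⟩ ⟨m, hm, l, rfl⟩
        refine ⟨n * m, mul_ne_zero hn hm, k + l, ?_⟩
        simp only [zsmul_eq_mul]
        push_cast
        ring }
  have hdis : Disjoint ((⊥ : Ideal A) : Set A) M := by
    rw [Set.disjoint_left]
    rintro a ha ⟨n, hn, k, hk⟩
    have ha0 : a = 0 := by simpa using ha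
    rw [ha0] at hk
    rcases smul_eq_zero.mp hk.symm with h | h
    · exact hn h
    · exact pow_ne_zero k hz h
  obtain ⟨p, hp, -, hd⟩ := Ideal.exists_le_prime_disjoint ⊥ M hdis
  rw [Set.disjoint_left] at hd
  have hinj : Function.Injective (algebraMap ℤ (A ⧸ p)) := by
    rw [injective_iff_map_eq_zero]
    intro n hn
    by_contra hne
    refine hd (a := (n : A)) ?_ ⟨n, hne, 0, by simp⟩
    have h2 : Ideal.Quotient.mk p (n : A) = 0 := by simpa using hn
    exact Ideal.Quotient.eq_zero_iff_mem.mp h2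
  have : FaithfulSMul ℤ (A ⧸ p) := (faithfulSMul_iff_algebraMap_injective _ _).mpr hinj
  have : Module.IsTorsionFree ℤ (A ⧸ p) := inferInstance
  let f : A ⧸ p →ₐ[ℤ] ℂ := IsAlgClosed.lift
  have hf : Function.Injective f := by
    have hi : Algebra.IsIntegral ℤ (A ⧸ p) := inferInstance
    have hc : Function.Injective ((f : A ⧸ p →+* ℂ).comp (algebraMap ℤ (A ⧸ p))) := by
      rw [Subsingleton.elim ((f : A ⧸ p →+* ℂ).comp (algebraMap ℤ (A ⧸ p))) (Int.castRingHom ℂ)]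
      exact Int.cast_injective
    have := Ideal.eq_bot_of_comap_eq_bot (R := ℤ) (I := RingHom.ker (f : A ⧸ p →+* ℂ)) (by
      rw [RingHom.comap_ker]
      exact (RingHom.injective_iff_ker_eq_bot _).mp hc)
    exact (RingHom.injective_iff_ker_eq_bot (f : A ⧸ p →+* ℂ)).mpr this
  refine ⟨(f : A ⧸ p →+* ℂ).comp (Ideal.Quotient.mk p), fun h => ?_⟩
  have h1 : Ideal.Quotient.mk p z = 0 := hf (by simpa using h)
  exact hd (Ideal.Quotient.eq_zero_iff_mem.mp h1) ⟨1, one_ne_zero, 1, by simp⟩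

/-- The product of the nonzero conjugates of `z` has absolute value at least one. -/
lemma ord_one_le_prod {A : Type*} [CommRing A] [Module.Finite ℤ A] [Fintype (A →+* ℂ)]
    (z : A) : 1 ≤ ∏ σ : A →+* ℂ, ‖(if σ z = 0 then 1 else σ z : ℂ)‖ := by
  classical
  set P : ℂ := ∏ σ : A →+* ℂ, (if σ z = 0 then 1 else σ z : ℂ) with hP
  have hIntegral : ∀ (σ : A →+* ℂ) (a : A), IsIntegral ℤ (σ a) := fun σ a =>
    (Algebra.IsIntegral.isIntegral (R := ℤ) a).map σ.toIntAlgHom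
  have hPint : IsIntegral ℤ P := by
    refine IsIntegral.prod _ fun σ _ => ?_
    split_ifs
    · exact isIntegral_one
    · exact hIntegral σ z
  have hP0 : P ≠ 0 := by
    refine Finset.prod_ne_zero_iff.mpr fun σ _ => ?_
    split_ifs with h
    · exact one_ne_zero
    · exact h
  let Q := algebraicClosure ℚ ℂ
  have hmem : ∀ (x : ℂ), IsIntegral ℤ x → x ∈ Q := fun x hx =>
    mem_algebraicClosure_iff.mpr (hx.tower_top (A := ℚ)).isAlgebraic
  let r : (A →+* ℂ) → (A →+* Q) := fun σ => σ.codRestrict Q.toSubfield (fun a => hmem _ (hIntegral σ a))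
  have hr : ∀ σ a, ((r σ a : Q) : ℂ) = σ a := fun σ a => rfl
  let act : (Q ≃ₐ[ℚ] Q) → (A →+* ℂ) → (A →+* ℂ) := fun τ σ =>
    (algebraMap Q ℂ).comp ((τ : Q →+* Q).comp (r σ))
  have hact : ∀ τ σ a, act τ σ a = ((τ (r σ a) : Q) : ℂ) := fun τ σ a => rfl
  have hract : ∀ τ σ a, r (act τ σ) a = τ (r σ a) := fun τ σ a => rfl
  have hinv : ∀ τ σ, act τ.symm (act τ σ) = σ := by
    intro τ σ
    ext a
    rw [hact, hract, AlgEquiv.symm_apply_apply, hr]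
  have hinv' : ∀ τ σ, act τ (act τ.symm σ) = σ := by
    intro τ σ
    ext a
    rw [hact, hract, AlgEquiv.apply_symm_apply, hr]
  let PQ : Q := ∏ σ : A →+* ℂ, (if σ z = 0 then 1 else r σ z : Q)
  have hPQ : (PQ : ℂ) = P := by
    have : algebraMap Q ℂ PQ = P := by
      rw [map_prod]
      refine Finset.prod_congr rfl fun σ _ => ?_
      split_ifs
      · simp
      · rfl
    exact this
  have hfix : ∀ τ : Q ≃ₐ[ℚ] Q, τ PQ = PQ := by
    intro τ
    rw [map_prod]
    refine Fintype.prod_equiv ⟨act τ, act τ.symm, hinv τ, hinv' τ⟩ _ _ fun σ => ?_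
    have h0 : (act τ σ) z = 0 ↔ σ z = 0 := by
      rw [hact, ← hr σ z]
      simp
    simp only [Equiv.coe_fn_mk, h0]
    split_ifs
    · simp
    · rfl
  have : IsAlgClosure ℚ Q := algebraicClosure.isAlgClosure ℚ ℂ
  have : IsGalois ℚ Q := IsAlgClosure.isGalois ℚ Q
  obtain ⟨q, hq⟩ := (InfiniteGalois.mem_range_algebraMap_iff_fixed (k := ℚ) PQ).mpr hfix
  have hqP : (q : ℂ) = P := by
    rw [← hPQ, ← hq]
    simp
  have hqint : IsIntegral ℤ q := by
    rw [← hqP] at hPint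
    exact (isIntegral_algebraMap_iff (algebraMap ℚ ℂ).injective).mp (by simpa using hPint)
  obtain ⟨n, hn⟩ := IsIntegrallyClosed.isIntegral_iff.mp hqint
  have hnP : (n : ℂ) = P := by
    rw [← hqP, ← hn]
    simp
  have hn0 : n ≠ 0 := by
    rintro rfl
    exact hP0 (by simpa using hnP.symm)
  rw [← norm_prod, ← hP, ← hnP, Complex.norm_intCast]
  exact_mod_cast Int.one_le_abs hn0

/-- Pointwise estimate. -/
lemma ord_pointwise (x y : ℂ) (h : x + y = 1) :
    2 * (x * (starRingEnd ℂ) y).re ≤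
      (if x * y = 0 then 0 else -1) - 2 * Real.log ‖(if x * y = 0 then 1 else x * y : ℂ)‖ := by
  split_ifs with h0
  · rcases mul_eq_zero.mp h0 with h1 | h1 <;> simp [h1]
  · have h1 := Real.log_le_sub_one_of_pos (norm_pos_iff.mpr h0)
    have h2 : ‖x + y‖ ^ 2 = ‖x‖ ^ 2 + ‖y‖ ^ 2 + 2 * (x * (starRingEnd ℂ) y).re := by
      simp only [← Complex.normSq_eq_norm_sq]
      exact Complex.normSq_add x y
    rw [h] at h2
    rw [norm_mul] at h1 ⊢
    simp only [norm_one] at h2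
    nlinarith [sq_nonneg (‖x‖ - ‖y‖)]

lemma ord_mul_eq_zero {A : Type*} [CommRing A] [IsReduced A]
    [Module.Free ℤ A] [Module.Finite ℤ A] (x y : A) (h : x + y = 1)
    (hp : 0 ≤ ordPairing A x y) : x * y = 0 := by
  classical
  have := ord_finite_homs A
  let := Fintype.ofFinite (A →+* ℂ)
  by_contra hz
  obtain ⟨σ₀, hσ₀⟩ := ord_exists_hom (x * y) hz
  rw [ordPairing, finsum_eq_sum_of_fintype] at hp
  have hprod := ord_one_le_prod (x * y)
  have hlog := Real.log_nonneg hprod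
  have hne : ∀ σ : A →+* ℂ, ‖(if σ (x * y) = 0 then 1 else σ (x * y) : ℂ)‖ ≠ 0 := by
    intro σ
    rw [norm_ne_zero_iff]
    split_ifs with h
    · exact one_ne_zero
    · exact h
  rw [Real.log_prod (fun σ _ => hne σ)] at hlog
  have hsum := Finset.sum_le_sum (s := Finset.univ) fun (σ : A →+* ℂ) _ =>
    ord_pointwise (σ x) (σ y) (by rw [← map_add, h, map_one])
  simp only [← map_mul, Finset.sum_sub_distrib, ← Finset.mul_sum] at hsum
  have hneg : ∑ σ : A →+* ℂ, (if σ (x * y) = 0 then (0 : ℝ) else -1) < 0 := by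
    refine Finset.sum_neg' (fun σ _ => ?_) ⟨σ₀, Finset.mem_univ _, ?_⟩
    · split_ifs <;> norm_num
    · rw [if_neg hσ₀]; norm_num
  simp only [map_mul] at hsum hlog hneg hp
  linarith

lemma ord_pairing_idem {A : Type*} [CommRing A] (e : A) (he : IsIdempotentElem e) :
    ordPairing A e (1 - e) = 0 := by
  rw [ordPairing]
  refine finsum_eq_zero_of_forall_eq_zero fun σ => ?_
  have h : σ e * (1 - σ e) = 0 := by
    have : e * (1 - e) = 0 := by rw [mul_sub, mul_one, he.eq, sub_self]
    simpa using congrArg σ this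
  rcases mul_eq_zero.mp h with h1 | h1 <;> simp [h1]

/-- In a reduced order, `e ↦ (e, 1-e)` is a bijection from the idempotents to
the decompositions of `1` (pairs `(x,y)` with `x + y = 1` and `⟨x,y⟩ ≥ 0`).
In particular `A` is connected iff `1` is indecomposable in the lattice `A`. -/
theorem idempotents_biject_decompositions {A : Type*} [CommRing A] [IsReduced A]
    [Module.Free ℤ A] [Module.Finite ℤ A] :
    Set.BijOn (fun e : A => (e, 1 - e)) {e : A | IsIdempotentElem e}
      {q : A × A | q.1 + q.2 = 1 ∧ 0 ≤ ordPairing A q.1 q.2} ∧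
    (((0 : A) ≠ 1 ∧ ∀ e : A, IsIdempotentElem e → e = 0 ∨ e = 1) ↔
      ((1 : A) ≠ 0 ∧
        ∀ x y : A, x + y = 1 → 0 ≤ ordPairing A x y → x = 0 ∨ y = 0)) := by
  have key : ∀ x y : A, x + y = 1 → 0 ≤ ordPairing A x y → IsIdempotentElem x := by
    intro x y h hp
    have h0 := ord_mul_eq_zero x y h hp
    have hy : y = 1 - x := eq_sub_of_add_eq' h
    rw [hy, mul_sub, mul_one] at h0
    exact (sub_eq_zero.mp h0).symm
  refine ⟨⟨?_, ?_, ?_⟩, ?_, ?_⟩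
  · intro e he
    exact ⟨by simp, (ord_pairing_idem e he).ge⟩
  · intro a _ b _ h
    exact congrArg Prod.fst h
  · rintro ⟨x, y⟩ ⟨h, hp⟩
    refine ⟨x, key x y h hp, ?_⟩
    exact Prod.ext rfl (eq_sub_of_add_eq' h).symm
  · rintro ⟨h01, hid⟩
    refine ⟨h01.symm, fun x y h hp => ?_⟩
    rcases hid x (key x y h hp) with h1 | h1
    · exact Or.inl h1
    · right
      rw [h1] at h
      simpa using h
  · rintro ⟨h10, hdec⟩
    refine ⟨h10.symm, fun e he => ?_⟩
    rcases hdec e (1 - e) (by simp) (ord_pairing_idem e he).ge with h1 | h1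
    · exact Or.inl h1
    · exact Or.inr (sub_eq_zero.mp h1).symm
end

section
/- Let A be an order graded by an abelian group Γ via (B_γ)_{γ∈Γ}, and suppose the subring B_1 is connected. Then every root of unity of A is homogeneous, i.e., μ(A) ⊆ ⋃_{γ∈Γ} B_γ. -/
/-- A `Γ`-grading of a commutative ring `A`: a family of additive subgroups
`B γ` with `B γ * B δ ⊆ B (γ*δ)` such that every element of `A` has a unique
finitely-supported decomposition into homogeneous components. -/
def IsGrading {A Γ : Type*} [CommRing A] [CommGroup Γ] (B : Γ → AddSubgroup A) : Prop :=
  (∀ γ δ : Γ, ∀ x ∈ B γ, ∀ y ∈ B δ, x * y ∈ B (γ * δ)) ∧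
  (∀ a : A, ∃! f : Γ →₀ A, (∀ γ, f γ ∈ B γ) ∧ f.sum (fun _ x => x) = a)



namespace RootsHomog

lemma unip {R : Type*} [CommRing R] (n : ℕ) (htf : ∀ x : R, (n : R) * x = 0 → x = 0)
    (u : R) (hu : u ^ n = 1) (hnil : IsNilpotent (u - 1)) : u = 1 := by
  obtain ⟨k, hk⟩ := hnil
  set x := u - 1 with hx
  have hu' : u = 1 + x := by rw [hx]; ring
  obtain ⟨g, hg⟩ : ∃ g, (1 + x) ^ n = 1 + n * x + g * x ^ 2 := by
    clear hu
    induction n with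
    | zero => exact ⟨0, by simp⟩
    | succ n ih =>
      have : ∀ m : ℕ, ∃ g, (1 + x) ^ m = 1 + m * x + g * x ^ 2 := by
        intro m
        induction m with
        | zero => exact ⟨0, by simp⟩
        | succ m ih =>
          obtain ⟨g, hg⟩ := ih
          refine ⟨g * (1 + x) + m, ?_⟩
          rw [pow_succ, hg]; push_cast; ring
      exact this (n + 1)
  have h1 : (n : R) * x = - g * x ^ 2 := by
    rw [← hu', hu] at hg
    linear_combination -hg
  have h2 : ∀ j : ℕ, (n : R) ^ j * x = (- g) ^ j * x ^ (j + 1) := by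
    intro j
    induction j with
    | zero => simp
    | succ j ih =>
      calc (n : R) ^ (j + 1) * x = n * ((n : R) ^ j * x) := by ring
        _ = (-g) ^ j * x ^ j * (n * x) := by rw [ih]; ring
        _ = _ := by rw [h1]; ring
  have h3 : (n : R) ^ k * x = 0 := by rw [h2, pow_succ, hk]; ring
  have h4 : ∀ j : ℕ, (n : R) ^ j * x = 0 → x = 0 := by
    intro j
    induction j with
    | zero => simp
    | succ j ih =>
      intro h
      exact ih (htf _ (by rw [← h]; ring))
  rw [hu', h4 k h3, add_zero]

lemma nil_of_hom {A : Type*} [CommRing A] [Module.Free ℤ A] [Module.Finite ℤ A]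
    (x : A) (hx : ∀ σ : A →+* ℂ, σ x = 0) : IsNilpotent x := by
  by_contra hn
  let S : Submonoid A :=
    (Submonoid.map (Int.castRingHom A) (nonZeroDivisors ℤ)) ⊔ Submonoid.powers x
  have hdis : Disjoint ((⊥ : Ideal A) : Set A) S := by
    rw [Set.disjoint_left]
    rintro y hy hyS
    obtain rfl : y = 0 := by simpa using hy
    obtain ⟨a, ⟨m, hm, rfl⟩, b, ⟨k, rfl⟩, hab⟩ := Submonoid.mem_sup.1 hyS
    have hm0 : m ≠ 0 := nonZeroDivisors.ne_zero hm
    have : m • x ^ k = 0 := by simpa [zsmul_eq_mul] using hab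
    rcases smul_eq_zero.1 this with h | h
    · exact hm0 h
    · exact hn ⟨k, h⟩
  obtain ⟨p, hp, -, hpS⟩ := Ideal.exists_le_prime_disjoint _ S hdis
  rw [Set.disjoint_right] at hpS
  have hxp : x ∉ p := hpS (Submonoid.mem_sup_right (Submonoid.mem_powers x))
  have hinj : ∀ m : ℤ, (m : A ⧸ p) = 0 → m = 0 := by
    intro m hm
    by_contra h0
    have : (m : A) ∉ p := hpS (Submonoid.mem_sup_left ⟨m, by simpa using h0, rfl⟩)
    apply this
    rw [← Ideal.Quotient.eq_zero_iff_mem]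
    simpa using hm
  have : CharZero (A ⧸ p) := by
    refine ⟨fun a b hab => ?_⟩
    have := hinj (a - b) (by push_cast; rw [hab, sub_self])
    omega
  let K := FractionRing (A ⧸ p)
  have : CharZero K := charZero_of_injective_algebraMap (IsFractionRing.injective (A ⧸ p) K)
  have : Algebra.IsIntegral ℤ (A ⧸ p) := inferInstance
  have : Algebra.IsAlgebraic ℤ (A ⧸ p) := inferInstance
  have : Algebra.IsAlgebraic ℤ K := (IsFractionRing.isAlgebraic_iff' ℤ (A ⧸ p) K).1 inferInstance
  let τ : K →ₐ[ℤ] ℂ := IsAlgClosed.lift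
  have h := hx ((τ : K →+* ℂ).comp ((algebraMap (A ⧸ p) K).comp (Ideal.Quotient.mk p)))
  apply hxp
  rw [← Ideal.Quotient.eq_zero_iff_mem]
  apply IsFractionRing.injective (A ⧸ p) K
  rw [map_zero]
  apply (τ : K →+* ℂ).injective
  rw [map_zero]
  exact h

lemma zero_or_one {A : Type*} [CommRing A] [Module.Finite ℤ A]
    (e : A) (he : ∀ σ : A →+* ℂ, ∃ r : ℝ, 0 ≤ r ∧ r ≤ 1 ∧ σ e = r) (σ : A →+* ℂ) :
    σ e = 0 ∨ σ e = 1 := by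
  by_cases h0 : σ e = 0
  · exact Or.inl h0
  right
  obtain ⟨s, hs⟩ := (Module.Finite.fg_top : (⊤ : Submodule ℤ A).FG)
  have hint : ∀ a : A, IsIntegral ℤ (σ a) := fun a =>
    (Algebra.IsIntegral.isIntegral (R := ℤ) a).map σ.toIntAlgHom
  let K := IntermediateField.adjoin ℚ (σ '' (s : Set A))
  have : Finite (σ '' (s : Set A)) := (s.finite_toSet.image σ).to_subtype
  have : FiniteDimensional ℚ K := IntermediateField.finiteDimensional_adjoin (by
    rintro _ ⟨a, -, rfl⟩
    exact (hint a).tower_top)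
  have : NumberField K := { to_charZero := inferInstance, to_finiteDimensional := inferInstance }
  have hmem : ∀ a : A, σ a ∈ K := by
    intro a
    have ha : a ∈ Submodule.span ℤ (s : Set A) := hs ▸ Submodule.mem_top
    induction ha using Submodule.span_induction with
    | mem x hx => exact IntermediateField.subset_adjoin _ _ ⟨x, hx, rfl⟩
    | zero => rw [map_zero]; exact zero_mem _
    | add x y _ _ hx hy => rw [map_add]; exact add_mem hx hy
    | smul m x _ hx => rw [map_zsmul]; exact zsmul_mem hx m
  let τ : A →+* K := σ.codRestrict K hmem
  have hτ : ∀ a, ((τ a : K) : ℂ) = σ a := fun a => rfl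
  obtain ⟨n, hn, hpow⟩ := NumberField.Embeddings.pow_eq_one_of_norm_le_one K ℂ (x := τ e)
    (fun h => h0 (by rw [← hτ, h]; rfl))
    ((Algebra.IsIntegral.isIntegral (R := ℤ) e).map τ.toIntAlgHom)
    (fun φ => by
      obtain ⟨r, hr0, hr1, hr⟩ := he (φ.comp τ)
      have : φ (τ e) = r := hr
      rw [this, Complex.norm_real, Real.norm_eq_abs, abs_of_nonneg hr0]
      exact hr1)
  obtain ⟨r, hr0, hr1, hr⟩ := he σ
  have h2 : (σ e) ^ n = 1 := by rw [← hτ, ← SubmonoidClass.coe_pow, hpow]; rfl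
  rw [hr] at h2 ⊢
  have h3 : r ^ n = 1 := by exact_mod_cast h2
  have : r = 1 := (pow_eq_one_iff_of_nonneg hr0 hn.ne').1 h3
  rw [this]; simp

lemma exists_char {Γ : Type*} [CommGroup Γ] (γ : Γ) (h : ∀ χ : Γ →* Circle, χ γ = 1) : γ = 1 := by
  have : Additive.ofMul γ = 0 := by
    apply CharacterModule.eq_zero_of_character_apply
    intro c
    let j : AddCircle (1 : ℚ) →+ AddCircle (1 : ℝ) :=
      QuotientAddGroup.map _ _ (Rat.castHom ℝ).toAddMonoidHom (by
        intro x hx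
        obtain ⟨m, rfl⟩ := AddSubgroup.mem_zmultiples_iff.1 hx
        exact AddSubgroup.mem_zmultiples_iff.2 ⟨m, by simp⟩)
    have hj : ∀ x, j x = 0 → x = 0 := by
      intro x
      induction x using QuotientAddGroup.induction_on with
      | H q =>
        intro hq
        have hq' : (((q : ℝ)) : AddCircle (1 : ℝ)) = 0 := hq
        rw [AddCircle.coe_eq_zero_iff] at hq'
        obtain ⟨m, hm⟩ := hq'
        change ((q : ℚ) : AddCircle (1 : ℚ)) = 0
        rw [AddCircle.coe_eq_zero_iff]
        refine ⟨m, ?_⟩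
        simp only [zsmul_eq_mul, mul_one] at hm ⊢
        exact_mod_cast hm
    let χ : Γ →* Circle :=
      { toFun := fun g => AddCircle.toCircle (j (c (Additive.ofMul g)))
        map_one' := by simp
        map_mul' := by intro a b; simp [AddCircle.toCircle_add] }
    have h1 : AddCircle.toCircle (j (c (Additive.ofMul γ))) = 1 := h χ
    rw [← AddCircle.toCircle_zero (T := 1)] at h1
    exact hj _ (AddCircle.injective_toCircle one_ne_zero h1)
  exact this

/-- Fourier uniqueness. -/
lemma fourier {Γ : Type*} [CommGroup Γ] (c : Γ →₀ ℂ)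
    (h : ∀ χ : Γ →* Circle, c.sum (fun γ z => z * (χ γ : ℂ)) = 0) : c = 0 := by
  let ev : Γ → ((Γ →* Circle) →* ℂ) := fun γ =>
    { toFun := fun χ => (χ γ : ℂ)
      map_one' := by simp
      map_mul' := by intro a b; simp }
  have hev : Function.Injective ev := by
    intro a b hab
    have : a * b⁻¹ = 1 := by
      apply exists_char
      intro χ
      have h1 : (χ a : ℂ) = χ b := DFunLike.congr_fun hab χ
      have h2 : χ a = χ b := Circle.ext h1
      rw [map_mul, map_inv, h2, mul_inv_cancel]
    exact mul_inv_eq_one.1 this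
  have hli := (linearIndependent_monoidHom (Γ →* Circle) ℂ).comp ev hev
  rw [linearIndependent_iff] at hli
  apply hli
  ext χ
  rw [Finsupp.linearCombination_apply, Finsupp.sum, Finset.sum_apply]
  exact h χ


/-- The evaluation homomorphism of a group ring attached to `σ` and `χ`. -/
noncomputable def evh {A Γ C : Type*} [CommRing A] [CommRing C] [CommGroup Γ] (σ : A →+* C)
    (χ : Γ →* C) : MonoidAlgebra A Γ →+* C :=
  MonoidAlgebra.liftNCRingHom σ χ (fun _ _ => Commute.all _ _)

lemma evh_single {A Γ C : Type*} [CommRing A] [CommRing C] [CommGroup Γ] (σ : A →+* C)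
    (χ : Γ →* C) (γ : Γ) (a : A) : evh σ χ (MonoidAlgebra.single γ a) = σ a * χ γ :=
  MonoidAlgebra.liftNC_single _ _ _ _

lemma evh_apply {A Γ C : Type*} [CommRing A] [CommRing C] [CommGroup Γ] (σ : A →+* C)
    (χ : Γ →* C) (F : MonoidAlgebra A Γ) :
    evh σ χ F = F.coeff.sum (fun γ a => σ a * χ γ) := rfl

lemma exists_hom {A Γ : Type*} [CommRing A] [CommGroup Γ]
    (B : Γ → AddSubgroup A) (hB : IsGrading B) :
    ∃ Φ : A →+* MonoidAlgebra A Γ, (∀ a γ, (Φ a).coeff γ ∈ B γ) ∧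
      (∀ a, (Φ a).coeff.sum (fun _ x => x) = a) ∧ (1 : A) ∈ B 1 := by
  obtain ⟨hmul, hdec⟩ := hB
  let ε : MonoidAlgebra A Γ →+* A := evh (RingHom.id A) 1
  have hε : ∀ F, ε F = F.coeff.sum (fun _ x => x) := by
    intro F
    simp [ε, evh_apply]
  let S : MonoidAlgebra A Γ → Prop := fun F => ∀ γ, F.coeff γ ∈ B γ
  have hinj : ∀ F G, S F → S G → ε F = ε G → F = G := by
    intro F G hF hG h
    have := (hdec (ε G)).unique (y₁ := F.coeff) (y₂ := G.coeff) ⟨hF, by rw [← hε, h]⟩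
      ⟨hG, by rw [← hε]⟩
    exact MonoidAlgebra.ext this
  have hSmul : ∀ F G, S F → S G → S (F * G) := by
    intro F G hF hG γ
    rw [MonoidAlgebra.coeff_mul_apply_left]
    refine sum_mem fun δ _ => ?_
    have := hmul δ (δ⁻¹ * γ) _ (hF δ) _ (hG (δ⁻¹ * γ))
    rwa [mul_inv_cancel_left] at this
  have hSadd : ∀ F G, S F → S G → S (F + G) := by
    intro F G hF hG γ
    rw [MonoidAlgebra.coeff_add]
    exact add_mem (hF γ) (hG γ)
  have hSsingle : ∀ γ, ∀ a ∈ B γ, S (MonoidAlgebra.single γ a) := by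
    intro γ a ha δ
    classical
    rw [MonoidAlgebra.coeff_single, Finsupp.single_apply]
    split_ifs with h
    · exact h ▸ ha
    · exact zero_mem _
  have hex : ∀ a, ∃ F, S F ∧ ε F = a := by
    intro a
    obtain ⟨f, hf, hs⟩ := (hdec a).exists
    exact ⟨MonoidAlgebra.ofCoeff f, hf, by rw [hε]; exact hs⟩
  choose Φ hΦS hΦε using hex
  have hone : (1 : A) ∈ B 1 := by
    have h1 : ∀ F, S F → F * Φ 1 = F := fun F hF =>
      hinj _ _ (hSmul _ _ hF (hΦS 1)) hF (by rw [map_mul, hΦε, mul_one])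
    have h2 := h1 _ (hSsingle 1 _ (hΦS 1 1))
    have h3 : ∀ γ, ∀ b ∈ B γ, b * (Φ 1).coeff 1 = b := by
      intro γ b hb
      have := congrArg (fun F => F.coeff γ) (h1 _ (hSsingle γ b hb))
      simpa [MonoidAlgebra.coeff_single_mul_apply] using this
    have h4 : (Φ 1).coeff 1 = 1 := by
      have h5 : ∀ a : A, a * (Φ 1).coeff 1 = a := by
        intro a
        conv_lhs => rw [← hΦε a, hε, Finsupp.sum, Finset.sum_mul]
        conv_rhs => rw [← hΦε a, hε, Finsupp.sum]
        exact Finset.sum_congr rfl fun γ _ => h3 γ _ (hΦS a γ)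
      simpa using h5 1
    rw [← h4]
    exact hΦS 1 1
  have hS1 : S 1 := hSsingle 1 1 hone
  have hS0 : S 0 := fun γ => by
    rw [MonoidAlgebra.coeff_zero]
    exact zero_mem _
  refine ⟨{ toFun := Φ, map_one' := ?_, map_zero' := ?_, map_mul' := ?_, map_add' := ?_ },
    hΦS, fun a => (hε _).symm.trans (hΦε a), hone⟩
  · exact hinj _ _ (hΦS _) hS1 (by rw [hΦε, map_one])
  · intro a b
    exact hinj _ _ (hΦS _) (hSmul _ _ (hΦS _) (hΦS _)) (by rw [map_mul, hΦε, hΦε, hΦε])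
  · exact hinj _ _ (hΦS _) hS0 (by rw [hΦε, map_zero])
  · intro a b
    exact hinj _ _ (hΦS _) (hSadd _ _ (hΦS _) (hΦS _)) (by rw [map_add, hΦε, hΦε, hΦε])

/-- On inverse roots of unity, complex conjugation inverts degrees. -/
lemma conj_coeff {A Γ : Type*} [CommRing A] [CommGroup Γ] (Φ : A →+* MonoidAlgebra A Γ)
    (ζ η : A) (n : ℕ) (hn : 0 < n) (hζ : ζ ^ n = 1) (hη : ζ * η = 1) (σ : A →+* ℂ) (γ : Γ) :
    σ ((Φ η).coeff γ⁻¹) = (starRingEnd ℂ) (σ ((Φ ζ).coeff γ)) := by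
  let c1 : Γ →₀ ℂ := (Φ η).coeff.mapRange σ (map_zero σ)
  let c2 : Γ →₀ ℂ := ((Φ ζ).coeff.mapRange (fun a => (starRingEnd ℂ) (σ a)) (by simp)).equivMapDomain
    (Equiv.inv Γ)
  have key : c1 - c2 = 0 := by
    apply fourier
    intro χ
    let χ' : Γ →* ℂ := (Circle.coeHom).comp χ
    let ψ : A →+* ℂ := (evh σ χ').comp Φ
    have h1 : c1.sum (fun γ z => z * (χ γ : ℂ)) = ψ η := by
      simp only [c1]
      rw [Finsupp.sum_mapRange_index (by simp)]
      rfl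
    have h2 : c2.sum (fun γ z => z * (χ γ : ℂ)) = (starRingEnd ℂ) (ψ ζ) := by
      simp only [c2]
      rw [Finsupp.sum_equivMapDomain, Finsupp.sum_mapRange_index (by simp)]
      change _ = (starRingEnd ℂ) (evh σ χ' (Φ ζ))
      rw [evh_apply, Finsupp.sum, Finsupp.sum, map_sum]
      refine Finset.sum_congr rfl fun γ _ => ?_
      have h0 : χ' γ = (χ γ : ℂ) := rfl
      rw [map_mul, h0, ← Circle.coe_inv_eq_conj, ← map_inv]
      rfl
    rw [Finsupp.sum_sub_index (by intros; ring), h1, h2]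
    have h3 : (ψ ζ) ^ n = 1 := by rw [← map_pow, hζ, map_one]
    have h4 : ‖ψ ζ‖ = 1 := Complex.norm_eq_one_of_pow_eq_one h3 hn.ne'
    have h5 : ψ ζ * ψ η = 1 := by rw [← map_mul, hη, map_one]
    have h6 : ψ ζ * (starRingEnd ℂ) (ψ ζ) = 1 := by
      rw [Complex.mul_conj, Complex.normSq_eq_norm_sq, h4]; simp
    have h7 : ψ ζ ≠ 0 := left_ne_zero_of_mul_eq_one h5
    exact sub_eq_zero.2 (mul_left_cancel₀ h7 (h5.trans h6.symm))
  have := DFunLike.congr_fun (sub_eq_zero.1 key) γ⁻¹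
  simpa [c1, c2, Finsupp.equivMapDomain_apply] using this

end RootsHomog

/-- In a graded order whose degree-one subring is connected, every root of
unity is homogeneous. -/
theorem rootsOfUnity_homogeneous {A Γ : Type*} [CommRing A]
    [Module.Free ℤ A] [Module.Finite ℤ A] [CommGroup Γ]
    (B : Γ → AddSubgroup A) (hB : IsGrading B)
    (hconn : (0 : A) ≠ 1 ∧ ∀ e ∈ B 1, IsIdempotentElem e → e = 0 ∨ e = 1) :
    ∀ ζ : A, (∃ n : ℕ, 0 < n ∧ ζ ^ n = 1) → ∃ γ : Γ, ζ ∈ B γ := by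
  classical
  rintro ζ ⟨n, hn, hζ⟩
  obtain ⟨h01, hidem⟩ := hconn
  obtain ⟨Φ, hΦB, hΦs, hone⟩ := RootsHomog.exists_hom B hB
  obtain ⟨η, hη⟩ : ∃ η : A, ζ * η = 1 :=
    ⟨ζ ^ (n - 1), by rw [← pow_succ', Nat.sub_add_cancel hn, hζ]⟩
  have hmul := hB.1
  have hpowB : ∀ x ∈ B 1, ∀ k : ℕ, x ^ k ∈ B 1 := by
    intro x hx k
    induction k with
    | zero => simpa using hone
    | succ k ih => rw [pow_succ]; simpa using hmul 1 1 _ ih _ hx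
  let e : Γ → A := fun γ => (Φ ζ).coeff γ * (Φ η).coeff γ⁻¹
  have heB : ∀ γ, e γ ∈ B 1 := by
    intro γ
    simpa using hmul _ _ _ (hΦB ζ γ) _ (hΦB η γ⁻¹)
  have heσ : ∀ (σ : A →+* ℂ) γ, σ (e γ) = ((Complex.normSq (σ ((Φ ζ).coeff γ)) : ℝ) : ℂ) := by
    intro σ γ
    rw [map_mul, RootsHomog.conj_coeff Φ ζ η n hn hζ hη, Complex.mul_conj]
  let s := (Φ ζ).coeff.support
  have hsum : ∑ γ ∈ s, e γ = 1 := by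
    have h1 : (Φ ζ * Φ η).coeff 1 = 1 := by
      rw [← map_mul, hη, RingHom.map_one, MonoidAlgebra.one_def]; simp
    rw [MonoidAlgebra.coeff_mul_apply_left, Finsupp.sum] at h1
    simpa [e] using h1
  have he0 : ∀ γ, γ ∉ s → e γ = 0 := by
    intro γ hγ
    have : (Φ ζ).coeff γ = 0 := by simpa [s] using hγ
    simp [e, this]
  have hsumσ : ∀ σ : A →+* ℂ, ∑ γ ∈ s, Complex.normSq (σ ((Φ ζ).coeff γ)) = 1 := by
    intro σ
    have h1 := congrArg σ hsum
    rw [map_sum, map_one, Finset.sum_congr rfl (fun γ _ => heσ σ γ)] at h1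
    exact_mod_cast h1
  have hez : ∀ γ (σ : A →+* ℂ), σ (e γ) = 0 ∨ σ (e γ) = 1 := by
    intro γ σ
    apply RootsHomog.zero_or_one
    intro σ
    refine ⟨_, Complex.normSq_nonneg _, ?_, heσ σ γ⟩
    by_cases hγ : γ ∈ s
    · rw [← hsumσ σ]
      exact Finset.single_le_sum (f := fun γ => Complex.normSq (σ ((Φ ζ).coeff γ)))
        (fun _ _ => Complex.normSq_nonneg _) hγ
    · have : (Φ ζ).coeff γ = 0 := by simpa [s] using hγ
      simp [this]
  have hdich : ∀ γ, (∀ σ : A →+* ℂ, σ (e γ) = 0) ∨ (∀ σ : A →+* ℂ, σ (e γ) = 1) := by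
    intro γ
    have hnil : IsNilpotent (e γ - e γ ^ 2) := by
      apply RootsHomog.nil_of_hom
      intro σ
      rcases hez γ σ with h | h <;> simp [h]
    obtain ⟨k, hk⟩ := hnil
    have hk' : (e γ - e γ ^ 2) ^ (k + 1) = 0 := by rw [pow_succ, hk, zero_mul]
    have hp := isIdempotentElem_one_sub_one_sub_pow_pow _ _ hk'
    have hpσ : ∀ σ : A →+* ℂ, σ (1 - (1 - e γ ^ (k + 1)) ^ (k + 1)) = σ (e γ) := by
      intro σ
      rcases hez γ σ with h | h <;> simp [h]
    rcases hidem _ (sub_mem hone (hpowB _ (sub_mem hone (hpowB _ (heB γ) _)) _)) hp with h | h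
    · left
      intro σ
      rw [← hpσ, h, map_zero]
    · right
      intro σ
      rw [← hpσ, h, map_one]
  obtain ⟨σ₀⟩ : Nonempty (A →+* ℂ) := by
    by_contra hne
    obtain ⟨k, hk⟩ := RootsHomog.nil_of_hom (1 : A) (fun σ => (hne ⟨σ⟩).elim)
    exact h01 (by rw [← hk, one_pow])
  obtain ⟨a, ha, haσ⟩ : ∃ a ∈ s, ∀ σ : A →+* ℂ, σ (e a) = 1 := by
    by_contra! hcon
    have h1 := congrArg σ₀ hsum
    rw [map_sum, map_one, Finset.sum_eq_zero] at h1
    · exact zero_ne_one h1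
    · intro γ hγ
      rcases hdich γ with h | h
      · exact h σ₀
      · obtain ⟨σ, hσ⟩ := hcon γ hγ
        exact absurd (h σ) hσ
  have hothers : ∀ b, b ≠ a → IsNilpotent ((Φ ζ).coeff b) := by
    intro b hb
    by_cases hbs : b ∈ s
    · apply RootsHomog.nil_of_hom
      intro σ
      have h1 := hsumσ σ
      have h2 : Complex.normSq (σ ((Φ ζ).coeff a)) = 1 := by
        have := haσ σ
        rw [heσ] at this
        exact_mod_cast this
      rw [← Finset.add_sum_erase _ _ ha, h2] at h1
      have h3 : ∑ γ ∈ s.erase a, Complex.normSq (σ ((Φ ζ).coeff γ)) = 0 := by linarith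
      rw [Finset.sum_eq_zero_iff_of_nonneg (fun _ _ => Complex.normSq_nonneg _)] at h3
      exact Complex.normSq_eq_zero.1 (h3 b (Finset.mem_erase.2 ⟨hb, hbs⟩))
    · have : (Φ ζ).coeff b = 0 := by simpa [s] using hbs
      rw [this]
      exact IsNilpotent.zero
  have hnil : IsNilpotent (Φ ζ - MonoidAlgebra.single a ζ) := by
    have h1 : Φ ζ - MonoidAlgebra.single a ζ = ∑ b ∈ s,
        MonoidAlgebra.single 1 ((Φ ζ).coeff b) *
          (MonoidAlgebra.single b 1 - MonoidAlgebra.single a 1) := by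
      simp only [mul_sub, MonoidAlgebra.single_mul_single, one_mul, mul_one,
        Finset.sum_sub_distrib]
      congr 1
      · exact (MonoidAlgebra.sum_coeff_single (Φ ζ)).symm
      · conv_lhs => rw [← hΦs ζ]
        exact map_sum (MonoidAlgebra.singleAddHom a) _ _
    rw [h1]
    apply isNilpotent_sum
    intro b _
    by_cases hb : b = a
    · simp [hb]
    · apply Commute.isNilpotent_mul_right (Commute.all _ _)
      exact (hothers b hb).map (MonoidAlgebra.singleOneRingHom (R := A) (M := Γ))
  let v : MonoidAlgebra A Γ := MonoidAlgebra.single a⁻¹ η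
  have hv : MonoidAlgebra.single a ζ * v = 1 := by
    simp only [v, MonoidAlgebra.single_mul_single, mul_inv_cancel, hη]
    rfl
  have hηn : η ^ n = 1 := by
    have : (ζ * η) ^ n = 1 := by rw [hη, one_pow]
    rwa [mul_pow, hζ, one_mul] at this
  have hu1 : IsNilpotent (Φ ζ * v - 1) := by
    rw [← hv, ← sub_mul]
    exact Commute.isNilpotent_mul_right (Commute.all _ _) hnil
  have hun : (Φ ζ * v) ^ n = MonoidAlgebra.single (a⁻¹ ^ n) 1 := by
    rw [mul_pow, ← map_pow, hζ, map_one, one_mul, MonoidAlgebra.single_pow, hηn]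
  have han : a⁻¹ ^ n = 1 := by
    apply RootsHomog.exists_char
    intro χ
    let ψ := RootsHomog.evh σ₀ ((Circle.coeHom).comp χ)
    have h1 : ψ (Φ ζ * v) = 1 := by
      have := (hu1.map ψ).eq_zero
      rw [map_sub, map_one] at this
      exact sub_eq_zero.1 this
    have h2 := congrArg ψ hun
    rw [map_pow, h1, one_pow, RootsHomog.evh_single, map_one, one_mul] at h2
    exact Circle.ext h2.symm
  have hu : Φ ζ * v = 1 := by
    refine RootsHomog.unip n ?_ _ ?_ hu1
    · intro F hF
      rw [← nsmul_eq_mul] at hF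
      apply MonoidAlgebra.ext
      ext γ
      have h1 := congrArg (fun F => F.coeff γ) hF
      have h2 : n • F.coeff γ = 0 := h1
      rw [← natCast_zsmul] at h2
      exact (smul_eq_zero.1 h2).resolve_left (by exact_mod_cast hn.ne')
    · rw [hun, han]; rfl
  have hfin : Φ ζ = MonoidAlgebra.single a ζ := by
    calc Φ ζ = Φ ζ * (MonoidAlgebra.single a ζ * v) := by rw [hv, mul_one]
      _ = (Φ ζ * v) * MonoidAlgebra.single a ζ := by ring
      _ = _ := by rw [hu, one_mul]
  refine ⟨a, ?_⟩
  have := hΦB ζ a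
  rw [hfin] at this
  simpa using this
end
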